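/- Let n be a positive integer, let a = a(n), b = b(n) be such that d := a + b > log n, and let G be a random graph drawn from the stochastic block model G_{2n, a/n, b/n}. Let A be the adjacency matrix of G and let B be its entrywise expectation. Then the probability that the spectral norm of A − B is at least 3·sqrt(d · log n) is at most 2/n. -/

import Mathlib

open MeasureTheory

/-- The Bernoulli measure on `Bool` with parameter `p`. -/
noncomputable def bern (p : ℝ) : Measure Bool :=
  p.toNNReal • Measure.dirac true + (1 - p).toNNReal • Measure.dirac false

/-- The stochastic block model `G_{2n,p,q}`: a symmetric random graph on `2n` vertices,
encoded by independent Bernoulli edge indicators `ω i j` (only the coordinates with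
`i ≤ j` are used by `adjOf`), where the pair `{i,j}` (self-loop pairs included) is an
edge with probability `p` if `i,j` are in the same community (`V₁ = {i | i < n}`,
`V₂ = {i | n ≤ i}`) and with probability `q` otherwise. -/
noncomputable def sbm (n : ℕ) (p q : ℝ) :
    Measure (Fin (2 * n) → Fin (2 * n) → Bool) :=
  Measure.pi fun i => Measure.pi fun j =>
    bern (if i.val < n ↔ j.val < n then p else q)

/-- The (symmetric, 0/1) adjacency matrix determined by the edge indicators `ω`. -/
noncomputable def adjOf {m : ℕ} (ω : Fin m → Fin m → Bool) : Matrix (Fin m) (Fin m) ℝ :=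
  Matrix.of fun i j => if i ≤ j then (if ω i j then 1 else 0) else (if ω j i then 1 else 0)

/-- The degree of vertex `i`. -/
noncomputable def deg {m : ℕ} (ω : Fin m → Fin m → Bool) (i : Fin m) : ℝ :=
  ∑ j, adjOf ω i j

/-- The spectral norm (ℓ²-operator norm) of a square real matrix. -/
noncomputable def specNorm {m : ℕ} (M : Matrix (Fin m) (Fin m) ℝ) : ℝ :=
  ‖Matrix.toEuclideanCLM (𝕜 := ℝ) M‖

/-- The expectation matrix `B = 𝔼[A]`: entries `a/n` within communities, `b/n` across. -/
noncomputable def Bmat (n : ℕ) (a b : ℝ) : Matrix (Fin (2*n)) (Fin (2*n)) ℝ :=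
  Matrix.of fun i j => if i.val < n ↔ j.val < n then a / n else b / n

open scoped Matrix Matrix.Norms.Operator Topology
open Filter NormedSpace

section BanachAlgebra

variable {R : Type*} [NormedRing R] [NormOneClass R]

theorem norm_pow_sub_pow_le (x y : R) {c : ℝ} (hc : 1 ≤ c) (hx : ‖x‖ ≤ c) (hy : ‖y‖ ≤ c) (k : ℕ) :
    ‖x ^ k - y ^ k‖ ≤ k * c ^ k * ‖x - y‖ := by
  induction k with
  | zero => simp
  | succ k ih =>
    have h0 : 0 ≤ c := by linarith
    have hxk : ‖x ^ k‖ ≤ c ^ (k + 1) :=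
      ((norm_pow_le x k).trans (pow_le_pow_left₀ (norm_nonneg _) hx k)).trans
        (pow_le_pow_right₀ hc k.le_succ)
    calc ‖x ^ (k + 1) - y ^ (k + 1)‖ = ‖x ^ k * (x - y) + (x ^ k - y ^ k) * y‖ := by
          congr 1; rw [pow_succ, pow_succ]; noncomm_ring
      _ ≤ ‖x ^ k‖ * ‖x - y‖ + ‖x ^ k - y ^ k‖ * ‖y‖ :=
          (norm_add_le _ _).trans <| add_le_add (norm_mul_le _ _) (norm_mul_le _ _)
      _ ≤ c ^ (k + 1) * ‖x - y‖ + (k * c ^ k * ‖x - y‖) * c := by gcongr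
      _ = ((k + 1 : ℕ) : ℝ) * c ^ (k + 1) * ‖x - y‖ := by push_cast; ring

variable [NormedAlgebra ℝ R]

theorem norm_exp_le_exp_norm (x : R) : ‖exp x‖ ≤ Real.exp ‖x‖ := by
  rw [exp_eq_tsum ℝ, Real.exp_eq_exp_ℝ, exp_eq_tsum ℝ]
  have hs : Summable fun n : ℕ => ((n.factorial : ℝ)⁻¹) • ‖x‖ ^ n :=
    expSeries_summable' (𝕂 := ℝ) ‖x‖
  refine tsum_of_norm_bounded hs.hasSum fun n => ?_
  rw [norm_smul, smul_eq_mul, Real.norm_of_nonneg (by positivity)]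
  gcongr
  exact norm_pow_le x n

variable [CompleteSpace R]

/-- The Lie–Trotter product formula. -/
theorem tendsto_exp_mul_exp_pow (A B : R) :
    Tendsto (fun k : ℕ => (exp ((k : ℝ)⁻¹ • A) * exp ((k : ℝ)⁻¹ • B)) ^ k) atTop
      (𝓝 (exp (A + B))) := by
  set f : ℝ → R := fun t => exp (t • A) * exp (t • B) - exp (t • (A + B)) with hf
  have hder : HasDerivAt f 0 0 := by
    have h := ((hasDerivAt_exp_smul_const A (0 : ℝ)).mul
      (hasDerivAt_exp_smul_const B (0 : ℝ))).sub (hasDerivAt_exp_smul_const (A + B) (0 : ℝ))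
    refine h.congr_deriv ?_
    simp
  have hlim : Tendsto (fun k : ℕ => (k : ℝ) * ‖f ((k : ℝ)⁻¹)‖) atTop (𝓝 0) := by
    have h1 := hasDerivAt_iff_tendsto_slope_zero.1 hder
    have h2 : Tendsto (fun k : ℕ => ((k : ℝ))⁻¹) atTop (𝓝[≠] 0) :=
      (tendsto_inv_atTop_nhdsGT_zero.mono_right
        (nhdsWithin_mono _ fun x hx => (ne_of_gt hx))).comp tendsto_natCast_atTop_atTop
    have h3 := (h1.comp h2).norm
    refine (h3.congr fun k => ?_).trans (by simp)
    have h0 : f 0 = 0 := by simp [hf]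
    simp [h0, norm_smul]
  rw [tendsto_iff_norm_sub_tendsto_zero]
  set C := Real.exp (‖A‖ + ‖B‖) with hC
  refine squeeze_zero' (g := fun k : ℕ => C * ((k : ℝ) * ‖f ((k : ℝ)⁻¹)‖))
    (Eventually.of_forall fun _ => norm_nonneg _) ?_ (by simpa using hlim.const_mul C)
  filter_upwards [eventually_gt_atTop 0] with k hk
  have hk' : (0 : ℝ) < k := by exact_mod_cast hk
  set c := Real.exp ((k : ℝ)⁻¹ * (‖A‖ + ‖B‖)) with hc
  have hck : c ^ k = C := by
    rw [hc, hC, ← Real.exp_nat_mul]; congr 1; field_simp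
  have hns (Z : R) : ‖(k : ℝ)⁻¹ • Z‖ = (k : ℝ)⁻¹ * ‖Z‖ := by
    rw [norm_smul, Real.norm_of_nonneg (by positivity)]
  have hpow : exp (A + B) = exp ((k : ℝ)⁻¹ • (A + B)) ^ k := by
    let _ : NormedAlgebra ℚ R := NormedAlgebra.restrictScalars ℚ ℝ R
    rw [← exp_nsmul, ← Nat.cast_smul_eq_nsmul ℝ, smul_smul, mul_inv_cancel₀ hk'.ne', one_smul]
  have hX : ‖exp ((k : ℝ)⁻¹ • A) * exp ((k : ℝ)⁻¹ • B)‖ ≤ c := by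
    refine (norm_mul_le _ _).trans ?_
    refine (mul_le_mul (norm_exp_le_exp_norm _) (norm_exp_le_exp_norm _) (norm_nonneg _)
      (Real.exp_nonneg _)).trans ?_
    rw [← Real.exp_add, hns, hns, ← mul_add]
  have hY : ‖exp ((k : ℝ)⁻¹ • (A + B))‖ ≤ c := by
    refine (norm_exp_le_exp_norm _).trans (Real.exp_le_exp.2 ?_)
    rw [hns]
    gcongr
    exact norm_add_le _ _
  rw [hpow]
  refine (norm_pow_sub_pow_le _ _ (Real.one_le_exp (by positivity)) hX hY k).trans_eq ?_
  rw [hck]; simp only [hf]; ring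

end BanachAlgebra

section GoldenThompson

variable {m : Type*} [Fintype m] [DecidableEq m]

theorem Matrix.tendsto_exp_mul_exp_pow [Nonempty m] (A B : Matrix m m ℝ) :
    Tendsto (fun k : ℕ => (exp ((k : ℝ)⁻¹ • A) * exp ((k : ℝ)⁻¹ • B)) ^ k) atTop
      (𝓝 (exp (A + B))) :=
  _root_.tendsto_exp_mul_exp_pow A B

theorem trace_mul_le_of_isSymm {X Y : Matrix m m ℝ} (hX : X.IsSymm) (hY : Y.IsSymm) :
    2 * (X * Y).trace ≤ (X ^ 2).trace + (Y ^ 2).trace := by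
  have h : 0 ≤ ((X - Y) * (X - Y)ᵀ).trace := by
    simpa using (Matrix.posSemidef_self_mul_conjTranspose (X - Y)).trace_nonneg
  rw [Matrix.transpose_sub, hX, hY] at h
  have e : ((X - Y) * (X - Y)) = X ^ 2 - X * Y - Y * X + Y ^ 2 := by noncomm_ring
  rw [e] at h
  simp only [Matrix.trace_add, Matrix.trace_sub, Matrix.trace_mul_comm Y X] at h
  linarith

theorem trace_sq_le (M : Matrix m m ℝ) : (M ^ 2).trace ≤ (M * Mᵀ).trace := by
  have h : 0 ≤ ((M - Mᵀ) * (M - Mᵀ)ᵀ).trace := by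
    simpa using (Matrix.posSemidef_self_mul_conjTranspose (M - Mᵀ)).trace_nonneg
  have e : (M - Mᵀ) * (M - Mᵀ)ᵀ = M * Mᵀ + Mᵀ * M - M ^ 2 - (M ^ 2)ᵀ := by
    rw [Matrix.transpose_sub, Matrix.transpose_transpose, Matrix.transpose_pow]; noncomm_ring
  rw [e] at h
  simp only [Matrix.trace_add, Matrix.trace_sub, Matrix.trace_mul_comm Mᵀ M,
    Matrix.trace_transpose] at h
  linarith

theorem trace_mul_pow_comm (A B : Matrix m m ℝ) (k : ℕ) :
    ((A * B) ^ k).trace = ((B * A) ^ k).trace := by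
  cases k with
  | zero => simp
  | succ k => rw [pow_succ, ← mul_assoc, mul_pow_mul, Matrix.trace_mul_comm, ← mul_assoc, pow_succ']

theorem trace_pow_two_pow_le (k : ℕ) :
    (∀ A B : Matrix m m ℝ, A.IsSymm → B.IsSymm →
      ((A * B) ^ 2 ^ k).trace ≤ (A ^ 2 ^ k * B ^ 2 ^ k).trace) ∧
    ∀ M : Matrix m m ℝ, (M ^ 2 ^ (k + 1)).trace ≤ ((M * Mᵀ) ^ 2 ^ k).trace := by
  induction k with
  | zero => exact ⟨by simp, fun M => by simpa using trace_sq_le M⟩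
  | succ k ih =>
    obtain ⟨ihP, ihQ⟩ := ih
    refine ⟨fun A B hA hB => ?_, fun M => ?_⟩
    · refine (ihQ (A * B)).trans ?_
      have e : A * B * (A * B)ᵀ = A * (B ^ 2 * A) := by
        rw [Matrix.transpose_mul, hA, hB, sq]; noncomm_ring
      rw [e, trace_mul_pow_comm]
      have e' : B ^ 2 * A * A = B ^ 2 * A ^ 2 := by noncomm_ring
      rw [e', trace_mul_pow_comm]
      refine (ihP _ _ (hA.pow 2) (hB.pow 2)).trans_eq ?_
      rw [← pow_mul, ← pow_mul, ← pow_succ']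
    · have h1 := ihQ (M ^ 2)
      rw [← pow_mul, ← pow_succ'] at h1
      refine h1.trans ?_
      have e : M ^ 2 * (M ^ 2)ᵀ = M * (M * Mᵀ * Mᵀ) := by
        rw [Matrix.transpose_pow]; noncomm_ring
      have e' : M * Mᵀ * Mᵀ * M = (M * Mᵀ) * (Mᵀ * M) := by noncomm_ring
      have s1 : (M * Mᵀ).IsSymm := Matrix.isSymm_mul_transpose_self M
      have s2 : (Mᵀ * M).IsSymm := Matrix.isSymm_transpose_mul_self M
      rw [e, trace_mul_pow_comm, e']
      refine (ihP _ _ s1 s2).trans ?_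
      have h2 := trace_mul_le_of_isSymm (s1.pow (2 ^ k)) (s2.pow (2 ^ k))
      rw [← pow_mul, ← pow_mul, ← pow_succ, trace_mul_pow_comm Mᵀ M] at h2
      linarith

/-- The Golden–Thompson inequality for real symmetric matrices. -/
theorem trace_exp_add_le {A B : Matrix m m ℝ} (hA : A.IsSymm) (hB : B.IsSymm) :
    (exp (A + B)).trace ≤ (exp A * exp B).trace := by
  rcases isEmpty_or_nonempty m with hm | hm
  · simp [Matrix.trace]
  have h := (Matrix.tendsto_exp_mul_exp_pow A B).comp
    (tendsto_pow_atTop_atTop_of_one_lt (one_lt_two : 1 < 2))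
  have ht : Continuous (Matrix.trace : Matrix m m ℝ → ℝ) := continuous_id.matrix_trace
  refine le_of_tendsto ((ht.tendsto _).comp h) (Eventually.of_forall fun k => ?_)
  have hp (Z : Matrix m m ℝ) : exp (((2 ^ k : ℕ) : ℝ)⁻¹ • Z) ^ 2 ^ k = exp Z := by
    rw [← Matrix.exp_nsmul, ← Nat.cast_smul_eq_nsmul ℝ, smul_smul,
      mul_inv_cancel₀ (by positivity), one_smul]
  have := (trace_pow_two_pow_le k).1 (exp (((2 ^ k : ℕ) : ℝ)⁻¹ • A))
    (exp (((2 ^ k : ℕ) : ℝ)⁻¹ • B)) (hA.smul _).exp (hB.smul _).exp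
  rwa [hp, hp] at this

end GoldenThompson

section BanachAlgebra

variable {R : Type*} [NormedRing R] [NormedAlgebra ℝ R] [CompleteSpace R]

theorem exp_smul_of_isIdempotentElem {q : R} (hq : IsIdempotentElem q) (x : ℝ) :
    exp (x • q) = 1 + (Real.exp x - 1) • q := by
  have h1 : HasSum (fun n : ℕ => ((n.factorial : ℝ)⁻¹ • x ^ n) • q) (Real.exp x • q) := by
    rw [Real.exp_eq_exp_ℝ]
    exact (exp_series_hasSum_exp' (𝕂 := ℝ) x).smul_const q
  have h2 : HasSum (fun n : ℕ => if n = 0 then 1 - q else 0) (1 - q) := hasSum_ite_eq 0 _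
  have h3 := exp_series_hasSum_exp' (𝕂 := ℝ) (x • q)
  have h4 := h3.unique ((h1.add h2).congr_fun ?_)
  · rw [h4, sub_smul, one_smul]; abel
  · intro n
    rcases n with _ | n
    · simp
    · simp [smul_pow, hq.pow_succ_eq, smul_smul]

theorem isIdempotentElem_of_pow_three_eq {R : Type*} [Ring R] [Algebra ℝ R] {J : R}
    (hJ : J ^ 3 = J) : IsIdempotentElem ((2⁻¹ : ℝ) • (J ^ 2 + J)) := by
  have h4 : J ^ 4 = J ^ 2 := by rw [pow_succ, hJ, sq]
  have e : (J ^ 2 + J) * (J ^ 2 + J) = J ^ 4 + 2 • J ^ 3 + J ^ 2 := by noncomm_ring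
  rw [IsIdempotentElem, smul_mul_smul_comm, e, h4, hJ]
  module

theorem exp_smul_sub_smul_sq {J : R} (hJ : J ^ 3 = J) (x y : ℝ) :
    exp (x • J - y • J ^ 2) = 1 + (Real.exp (x - y) - 1) • ((2⁻¹ : ℝ) • (J ^ 2 + J)) +
      (Real.exp (-x - y) - 1) • ((2⁻¹ : ℝ) • (J ^ 2 - J)) := by
  have h4 : J ^ 4 = J ^ 2 := by rw [pow_succ, hJ, sq]
  have hp := isIdempotentElem_of_pow_three_eq hJ
  have hm := isIdempotentElem_of_pow_three_eq (J := -J) (by rw [Odd.neg_pow (by decide), hJ])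
  rw [neg_sq, ← sub_eq_add_neg] at hm
  set P := (2⁻¹ : ℝ) • (J ^ 2 + J) with hP
  set M := (2⁻¹ : ℝ) • (J ^ 2 - J) with hM
  have hPM : P * M = 0 := by
    have e : (J ^ 2 + J) * (J ^ 2 - J) = J ^ 4 - J ^ 2 := by noncomm_ring
    rw [hP, hM, smul_mul_smul_comm, e, h4, sub_self, smul_zero]
  have hMP : M * P = 0 := by
    have e : (J ^ 2 - J) * (J ^ 2 + J) = J ^ 4 - J ^ 2 := by noncomm_ring
    rw [hP, hM, smul_mul_smul_comm, e, h4, sub_self, smul_zero]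
  have hcomm : Commute ((x - y) • P) ((-x - y) • M) :=
    Commute.smul_left (Commute.smul_right (hPM.trans hMP.symm) _) _
  have hsplit : x • J - y • J ^ 2 = (x - y) • P + (-x - y) • M := by
    rw [hP, hM]; module
  let _ : NormedAlgebra ℚ R := NormedAlgebra.restrictScalars ℚ ℝ R
  rw [hsplit, exp_add_of_commute hcomm, exp_smul_of_isIdempotentElem hp,
    exp_smul_of_isIdempotentElem hm]
  simp [add_mul, mul_add, hPM]

end BanachAlgebra

section MGF

theorem exp_mul_le_of_abs_le_one {s : ℝ} (hs : |s| ≤ 1) (y : ℝ) :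
    Real.exp (s * y) ≤ 1 + s * y + s ^ 2 * (Real.exp |y| - 1 - |y|) := by
  have hsum (x : ℝ) : HasSum (fun n : ℕ => x ^ (n + 2) / ((n + 2).factorial : ℝ))
      (Real.exp x - (1 + x)) := by
    rw [Real.exp_eq_exp_ℝ]
    have h := (hasSum_nat_add_iff' 2).2 (expSeries_div_hasSum_exp x)
    simpa [Finset.sum_range_succ] using h
  have h := hasSum_le (fun n => ?_) (hsum (s * y)) ((hsum |y|).mul_left (s ^ 2))
  · linarith
  · rw [← mul_div_assoc]
    gcongr
    calc (s * y) ^ (n + 2) ≤ |s * y| ^ (n + 2) := by rw [← abs_pow]; exact le_abs_self _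
      _ = |s| ^ n * (s ^ 2 * |y| ^ (n + 2)) := by rw [abs_mul, mul_pow, pow_add, sq_abs]; ring
      _ ≤ 1 * (s ^ 2 * |y| ^ (n + 2)) := by
        gcongr
        exact pow_le_one₀ (abs_nonneg _) hs
      _ = _ := one_mul _

theorem bernoulli_mgf_le {p : ℝ} (hp0 : 0 ≤ p) (hp1 : p ≤ 1) (θ : ℝ) :
    p * Real.exp ((1 - p) * θ) + (1 - p) * Real.exp (-p * θ) ≤
      Real.exp (p * (1 - p) * (Real.exp |θ| - 1 - |θ|)) := by
  have h1 := exp_mul_le_of_abs_le_one (s := 1 - p) (abs_le.2 ⟨by linarith, by linarith⟩) θ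
  have h2 := exp_mul_le_of_abs_le_one (s := -p) (abs_le.2 ⟨by linarith, by linarith⟩) θ
  have h3 := Real.add_one_le_exp (p * (1 - p) * (Real.exp |θ| - 1 - |θ|))
  have h4 := mul_le_mul_of_nonneg_left h1 hp0
  have h5 := mul_le_mul_of_nonneg_left h2 (sub_nonneg.2 hp1)
  nlinarith

end MGF

section TraceExp

variable {m : Type*} [Fintype m] [DecidableEq m]

theorem trace_exp_mul_nonneg {H Q : Matrix m m ℝ} (hH : H.IsSymm) (hQ : Q.IsSymm)
    (hQQ : IsIdempotentElem Q) : 0 ≤ (exp H * Q).trace := by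
  set S := exp ((2⁻¹ : ℝ) • H) with hS
  have hSS : exp H = S * S := by
    rw [hS, ← Matrix.exp_add_of_commute _ _ (Commute.refl _), ← add_smul]; norm_num
  have hSs : S.IsSymm := (hH.smul _).exp
  have h : 0 ≤ ((Q * S) * (Q * S)ᵀ).trace := by
    simpa using (Matrix.posSemidef_self_mul_conjTranspose (Q * S)).trace_nonneg
  rw [Matrix.transpose_mul, hQ, hSs, mul_assoc, Matrix.trace_mul_comm] at h
  rw [hSS, ← hQQ.eq]
  simpa [mul_assoc] using h

/-- A random symmetric matrix `Y` is trace-exp contractive when adding it to any fixed symmetric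
matrix does not increase the trace of the matrix exponential on average. -/
def TraceExpContractive {Ω : Type*} [MeasurableSpace Ω] (μ : Measure Ω)
    (Y : Ω → Matrix m m ℝ) : Prop :=
  (∀ ω, (Y ω).IsSymm) ∧
    ∀ H : Matrix m m ℝ, H.IsSymm → ∫ ω, (exp (H + Y ω)).trace ∂μ ≤ (exp H).trace

theorem TraceExpContractive.pi {α : Type*} [Finite α] [MeasurableSpace α]
    [MeasurableSingletonClass α] {k : ℕ} (μ : Fin k → Measure α) [∀ i, IsProbabilityMeasure (μ i)]
    (Y : Fin k → α → Matrix m m ℝ) (hY : ∀ i, TraceExpContractive (μ i) (Y i)) :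
    TraceExpContractive (Measure.pi μ) fun ω => ∑ i, Y i (ω i) := by
  induction k with
  | zero => exact ⟨fun ω => by simp [Matrix.IsSymm], fun H _ => by simp⟩
  | succ k ih =>
    refine ⟨fun ω => ?_, fun H hH => ?_⟩
    · rw [Matrix.IsSymm, Matrix.transpose_sum]
      exact Finset.sum_congr rfl fun i _ => (hY i).1 _
    have ih' := ih (fun i => μ i.succ) (fun i => Y i.succ) fun i => hY i.succ
    have hmp := measurePreserving_piFinSuccAbove μ 0
    have e : ∫ ω, (exp (H + ∑ i, Y i (ω i))).trace ∂Measure.pi μ =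
        ∫ z : α × (Fin k → α), (exp (H + Y 0 z.1 + ∑ i : Fin k, Y i.succ (z.2 i))).trace
          ∂((μ 0).prod (Measure.pi fun j => μ (Fin.succ j))) := by
      have := hmp.integral_comp' (g := fun z : α × (Fin k → α) =>
        (exp (H + Y 0 z.1 + ∑ i : Fin k, Y i.succ (z.2 i))).trace)
      refine Eq.trans ?_ this
      simp [Fin.sum_univ_succ, add_assoc, MeasurableEquiv.piFinSuccAbove, Fin.tail]
    rw [e, integral_prod _ .of_finite]
    refine le_trans (integral_mono .of_finite .of_finite fun x => ?_) ((hY 0).2 H hH)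
    exact ih'.2 _ (hH.add ((hY 0).1 x))

theorem isProbabilityMeasure_bern {p : ℝ} (hp0 : 0 ≤ p) (hp1 : p ≤ 1) :
    IsProbabilityMeasure (bern p) := by
  constructor
  simp only [bern, Measure.add_apply, Measure.smul_apply, measure_univ, ENNReal.smul_def,
    smul_eq_mul, mul_one]
  rw [← ENNReal.coe_add, ← Real.toNNReal_add hp0 (by linarith)]
  simp

theorem integral_bern {p : ℝ} (hp0 : 0 ≤ p) (hp1 : p ≤ 1) (f : Bool → ℝ) :
    ∫ b, f b ∂bern p = p * f true + (1 - p) * f false := by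
  rw [bern, integral_add_measure .of_finite .of_finite]
  simp [integral_smul_nnreal_measure, NNReal.smul_def, hp0, hp1]

theorem TraceExpContractive.bern {p : ℝ} (hp0 : 0 ≤ p) (hp1 : p ≤ 1) (θ : ℝ) {J : Matrix m m ℝ}
    (hJ : J.IsSymm) (hJ3 : J ^ 3 = J) :
    TraceExpContractive (bern p) fun b =>
      (((if b then 1 else 0) - p) * θ) • J -
        (p * (1 - p) * (Real.exp |θ| - 1 - |θ|)) • J ^ 2 := by
  have hs (x y : ℝ) : (x • J - y • J ^ 2).IsSymm := (hJ.smul _).sub ((hJ.pow 2).smul _)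
  refine ⟨fun b => hs _ _, fun H hH => ?_⟩
  set w := p * (1 - p) * (Real.exp |θ| - 1 - |θ|) with hw
  have h4 : J ^ 4 = J ^ 2 := by rw [pow_succ, hJ3, sq]
  have key (x : ℝ) : (exp (H + (x • J - w • J ^ 2))).trace ≤ (exp H).trace +
      (Real.exp (x - w) - 1) * (exp H * ((2⁻¹ : ℝ) • (J ^ 2 + J))).trace +
      (Real.exp (-x - w) - 1) * (exp H * ((2⁻¹ : ℝ) • (J ^ 2 - J))).trace := by
    refine (trace_exp_add_le hH (hs _ _)).trans_eq ?_
    rw [show exp (x • J - w • J ^ 2) = _ from exp_smul_sub_smul_sq hJ3 x w]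
    simp only [mul_add, mul_one, Matrix.trace_add, mul_smul_comm, Matrix.trace_smul, smul_eq_mul]
  have hplus : 0 ≤ (exp H * ((2⁻¹ : ℝ) • (J ^ 2 + J))).trace :=
    trace_exp_mul_nonneg hH (((hJ.pow 2).add hJ).smul _) (isIdempotentElem_of_pow_three_eq hJ3)
  have hminus : 0 ≤ (exp H * ((2⁻¹ : ℝ) • (J ^ 2 - J))).trace :=
    trace_exp_mul_nonneg hH (((hJ.pow 2).sub hJ).smul _) <| by
      have h := isIdempotentElem_of_pow_three_eq (J := -J) (by rw [Odd.neg_pow (by decide), hJ3])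
      rwa [neg_sq, ← sub_eq_add_neg] at h
  rw [integral_bern hp0 hp1]
  simp only [if_true, Bool.false_eq_true, if_false]
  have k1 := mul_le_mul_of_nonneg_left (key ((1 - p) * θ)) hp0
  have k2 := mul_le_mul_of_nonneg_left (key ((0 - p) * θ)) (sub_nonneg.2 hp1)
  have mgf (t : ℝ) (ht : |t| = |θ|) :
      p * Real.exp ((1 - p) * t - w) + (1 - p) * Real.exp (-p * t - w) ≤ 1 := by
    have := bernoulli_mgf_le hp0 hp1 t
    rw [ht, ← hw] at this
    rw [Real.exp_sub, Real.exp_sub, ← mul_div_assoc, ← mul_div_assoc, ← add_div]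
    exact div_le_one_of_le₀ this (Real.exp_nonneg _)
  have m1 := mul_le_mul_of_nonneg_right (mgf θ rfl) hplus
  have m2 := mul_le_mul_of_nonneg_right (mgf (-θ) (abs_neg θ)) hminus
  ring_nf at k1 k2 m1 m2 ⊢
  linarith

end TraceExp

section SpectralNorm

variable {m : Type*} [Fintype m] [DecidableEq m]

theorem dotProduct_mulVec_le_of_trace_exp_le {K : Matrix m m ℝ} (hK : K.IsSymm) {c : ℝ}
    (hc : (exp K).trace ≤ Real.exp c) (x : m → ℝ) : x ⬝ᵥ K *ᵥ x ≤ c * (x ⬝ᵥ x) := by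
  have hH : K.IsHermitian := by simpa [Matrix.IsHermitian] using hK.eq
  set U : Matrix m m ℝ := ↑hH.eigenvectorUnitary with hU
  have hUU : U * Uᴴ = 1 := Unitary.coe_mul_star_self hH.eigenvectorUnitary
  have hUU' : Uᴴ * U = 1 := Unitary.coe_star_mul_self hH.eigenvectorUnitary
  have hKd : K = U * Matrix.diagonal hH.eigenvalues * Uᴴ := by
    rw [hU, ← Matrix.star_eq_conjTranspose]
    simpa [Unitary.conjStarAlgAut_apply] using hH.spectral_theorem
  have hinv : U⁻¹ = Uᴴ := Matrix.inv_eq_right_inv hUU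
  have hexp : (exp K).trace = ∑ i, Real.exp (hH.eigenvalues i) := by
    have h := Matrix.exp_conj U (Matrix.diagonal hH.eigenvalues)
      ((Matrix.isUnit_iff_isUnit_det _).2 (Matrix.isUnit_det_of_right_inverse hUU))
    rw [hinv, ← hKd] at h
    rw [h, Matrix.trace_mul_comm, ← mul_assoc, hUU', one_mul, Matrix.exp_diagonal,
      Matrix.trace_diagonal]
    simp [Real.exp_eq_exp_ℝ]
  have hle (i : m) : hH.eigenvalues i ≤ c := by
    rw [← Real.exp_le_exp]
    refine le_trans ?_ (hexp ▸ hc)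
    exact Finset.single_le_sum (f := fun i => Real.exp (hH.eigenvalues i))
      (fun _ _ => Real.exp_nonneg _) (Finset.mem_univ i)
  have hpos : (c • (1 : Matrix m m ℝ) - K).PosSemidef := by
    have e : c • (1 : Matrix m m ℝ) - K =
        U * Matrix.diagonal (fun i => c - hH.eigenvalues i) * Uᴴ := by
      have e1 : Matrix.diagonal (fun i => c - hH.eigenvalues i) =
          c • (1 : Matrix m m ℝ) - Matrix.diagonal hH.eigenvalues := by
        rw [Matrix.smul_one_eq_diagonal, Matrix.diagonal_sub]
      rw [e1, mul_sub, sub_mul, ← hKd, mul_smul_comm, mul_one, smul_mul_assoc, hUU]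
    rw [e]
    exact (Matrix.PosSemidef.diagonal fun i => sub_nonneg.2 (hle i)).mul_mul_conjTranspose_same U
  have h := hpos.dotProduct_mulVec_nonneg x
  simpa [Matrix.sub_mulVec, Matrix.smul_mulVec, dotProduct_sub] using h

theorem trace_exp_nonneg {K : Matrix m m ℝ} (hK : K.IsSymm) : 0 ≤ (exp K).trace := by
  simpa using trace_exp_mul_nonneg hK Matrix.isSymm_one IsIdempotentElem.one

theorem specNorm_le_of_abs_dotProduct_le {k : ℕ} {M : Matrix (Fin k) (Fin k) ℝ} (hM : M.IsSymm)
    {c : ℝ} (hc : 0 ≤ c) (h : ∀ x, |x ⬝ᵥ M *ᵥ x| ≤ c * (x ⬝ᵥ x)) : specNorm M ≤ c := by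
  have hS : (Matrix.toEuclideanCLM (𝕜 := ℝ) M).IsSymmetric := by
    rw [Matrix.coe_toEuclideanCLM_eq_toEuclideanLin, Matrix.isSymmetric_toEuclideanLin_iff]
    simpa [Matrix.IsHermitian] using hM.eq
  rw [specNorm, ContinuousLinearMap.norm_eq_iSup_rayleighQuotient _ hS]
  refine ciSup_le fun x => ?_
  rw [ContinuousLinearMap.rayleighQuotient, abs_div, abs_of_nonneg (sq_nonneg ‖x‖)]
  refine div_le_of_le_mul₀ (sq_nonneg _) hc ?_
  rw [ContinuousLinearMap.reApplyInnerSelf_apply, real_inner_comm, Matrix.inner_toEuclideanCLM]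
  have e : ‖x‖ ^ 2 = x.ofLp ⬝ᵥ x.ofLp := by
    rw [EuclideanSpace.real_norm_sq_eq]
    simp [dotProduct, sq]
  rw [e]
  exact h _

/-- The spectral norm is controlled by the exponential traces of the matrix and its negation. -/
theorem exp_specNorm_le {k : ℕ} (hk : 0 < k) {M : Matrix (Fin k) (Fin k) ℝ} (hM : M.IsSymm)
    {θ : ℝ} (hθ : 0 < θ) (v : ℝ) :
    Real.exp (θ * specNorm M - v) ≤
      (exp (θ • M - v • 1)).trace + (exp (-θ • M - v • 1)).trace := by
  have : Nonempty (Fin k) := ⟨⟨0, hk⟩⟩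
  have hs (x : ℝ) : (x • M - v • 1).IsSymm := (hM.smul _).sub (Matrix.isSymm_one.smul _)
  have hpos (x : ℝ) : 0 ≤ (exp (x • M - v • 1)).trace := trace_exp_nonneg (hs x)
  set T := (exp (θ • M - v • 1)).trace + (exp (-θ • M - v • 1)).trace with hT
  have hquad (x : ℝ) (hx : (exp (x • M - v • 1)).trace ≤ T) {c : ℝ} (hc : T ≤ Real.exp c)
      (z : Fin k → ℝ) : x * (z ⬝ᵥ M *ᵥ z) ≤ (c + v) * (z ⬝ᵥ z) := by
    have h := dotProduct_mulVec_le_of_trace_exp_le (hs x) (hx.trans hc) z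
    simp only [Matrix.sub_mulVec, Matrix.smul_mulVec, dotProduct_sub, dotProduct_smul,
      Matrix.one_mulVec, smul_eq_mul] at h
    linarith
  have habs {c : ℝ} (hc : T ≤ Real.exp c) (z : Fin k → ℝ) :
      θ * |z ⬝ᵥ M *ᵥ z| ≤ (c + v) * (z ⬝ᵥ z) := by
    have h1 := hquad θ (by linarith [hpos (-θ)]) hc z
    have h2 := hquad (-θ) (by linarith [hpos θ]) hc z
    rcases abs_cases (z ⬝ᵥ M *ᵥ z) with h | h <;> rw [h.1] <;> linarith
  have hle {c : ℝ} (hc : T ≤ Real.exp c) : θ * specNorm M - v ≤ c := by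
    have hcv : 0 ≤ c + v := by
      have h := habs hc (Pi.single ⟨0, hk⟩ 1)
      rw [single_dotProduct, single_dotProduct, Pi.single_eq_same, one_mul, mul_one, mul_one] at h
      exact le_trans (by positivity) h
    have h := specNorm_le_of_abs_dotProduct_le hM (div_nonneg hcv hθ.le) fun z => by
      have := habs hc z
      rw [div_mul_eq_mul_div, le_div_iff₀ hθ]
      linarith
    rw [le_div_iff₀ hθ] at h
    linarith
  refine le_of_forall_pos_le_add fun ε hε => ?_
  have hTε : 0 < T + ε := by linarith [hpos θ, hpos (-θ)]
  rw [← Real.le_log_iff_exp_le hTε]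
  exact hle (by rw [Real.exp_log hTε]; linarith)

end SpectralNorm

section EdgeMatrix

variable {k : ℕ}

/-- The adjacency matrix of the single edge `{i, j}` with `i ≤ j`, and zero if `j < i`. -/
def edgeMatrix (i j : Fin k) : Matrix (Fin k) (Fin k) ℝ :=
  (if i ≤ j then Matrix.single i j 1 else 0) + if i < j then Matrix.single j i 1 else 0

theorem edgeMatrix_isSymm (i j : Fin k) : (edgeMatrix i j).IsSymm := by
  rcases lt_trichotomy i j with h | rfl | h
  · simp [edgeMatrix, Matrix.IsSymm, h, h.le, add_comm]
  · simp [edgeMatrix, Matrix.IsSymm]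
  · simp [edgeMatrix, Matrix.IsSymm, h.not_ge, h.not_gt]

theorem edgeMatrix_sq (i j : Fin k) : edgeMatrix i j ^ 2 =
    (if i ≤ j then Matrix.single i i 1 else 0) + if i < j then Matrix.single j j 1 else 0 := by
  rcases lt_trichotomy i j with h | rfl | h
  · simp [edgeMatrix, h, h.le, sq, add_mul, mul_add, h.ne, h.ne', add_comm]
  · simp [edgeMatrix, sq]
  · simp [edgeMatrix, h.not_ge, h.not_gt]

theorem edgeMatrix_pow_three (i j : Fin k) : edgeMatrix i j ^ 3 = edgeMatrix i j := by
  rw [pow_succ, edgeMatrix_sq]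
  rcases lt_trichotomy i j with h | rfl | h
  · simp [edgeMatrix, h, h.le, add_mul, mul_add, h.ne, h.ne']
  · simp [edgeMatrix]
  · simp [edgeMatrix, h.not_ge, h.not_gt]

theorem sum_smul_edgeMatrix (c : Fin k → Fin k → ℝ) :
    ∑ i, ∑ j, c i j • edgeMatrix i j = Matrix.of fun i j => if i ≤ j then c i j else c j i := by
  ext s t
  have e (i j : Fin k) : (c i j • edgeMatrix i j) s t =
      (if i = s then if j = t then if i ≤ j then c i j else 0 else 0 else 0) +
      (if i = t then if j = s then if i < j then c i j else 0 else 0 else 0) := by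
    simp only [edgeMatrix, Matrix.smul_apply, Matrix.add_apply, smul_eq_mul]
    split_ifs <;> simp_all
  simp only [Matrix.sum_apply, e, Finset.sum_add_distrib]
  rcases le_or_gt s t with h | h
  · simp [h, h.not_gt]
  · simp [h, h.not_ge]

theorem sum_smul_edgeMatrix_sq {w : Fin k → Fin k → ℝ} (hw : ∀ i j, w i j = w j i) :
    ∑ i, ∑ j, w i j • edgeMatrix i j ^ 2 = Matrix.diagonal fun i => ∑ j, w i j := by
  ext s t
  have e (i j : Fin k) : (w i j • edgeMatrix i j ^ 2) s t =
      if s = t then (if i = s then if i ≤ j then w i j else 0 else 0) +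
        (if j = s then if i < j then w i j else 0 else 0) else 0 := by
    simp only [edgeMatrix_sq, Matrix.smul_apply, Matrix.add_apply, smul_eq_mul]
    split_ifs <;> simp_all
  simp only [Matrix.sum_apply, e, Matrix.diagonal_apply]
  by_cases h : s = t
  · simp only [h, if_true, Finset.sum_add_distrib]
    rw [Finset.sum_comm]
    simp only [Finset.sum_ite_eq', Finset.mem_univ, if_true]
    rw [← Finset.sum_add_distrib]
    refine Finset.sum_congr rfl fun j _ => ?_
    rcases le_or_gt t j with h | h
    · simp [h, h.not_gt]
    · simp [h, h.not_ge, hw j t]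
  · simp [h]

end EdgeMatrix

section BlockModel

theorem sum_block_ite (n : ℕ) (k : Fin (2 * n)) (x y : ℝ) :
    ∑ j : Fin (2 * n), (if k.val < n ↔ j.val < n then x else y) = n * (x + y) := by
  have h (x y : ℝ) : ∑ j : Fin (2 * n), (if j.val < n then x else y) = n * (x + y) := by
    rw [Fin.sum_univ_eq_sum_range (fun j => if j < n then x else y), two_mul,
      Finset.sum_range_add, Finset.sum_congr rfl fun j hj => if_pos (Finset.mem_range.1 hj)]
    simp [mul_add]
  by_cases hk : k.val < n
  · simpa [hk] using h x y
  · have e (j : Fin (2 * n)) : (if j.val < n then y else x) = if n ≤ j.val then x else y := by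
      split_ifs <;> first | rfl | omega
    simpa [hk, add_comm, e] using h y x

theorem adjOf_sub_Bmat_isSymm (n : ℕ) (a b : ℝ) (ω : Fin (2 * n) → Fin (2 * n) → Bool) :
    (adjOf ω - Bmat n a b).IsSymm := by
  ext i j
  have hB : Bmat n a b j i = Bmat n a b i j := by simp [Bmat, iff_comm]
  have hA : adjOf ω j i = adjOf ω i j := by
    rcases lt_trichotomy i j with h | rfl | h
    · simp [adjOf, h.le, h.not_ge]
    · rfl
    · simp [adjOf, h.le, h.not_ge]
  simp [hA, hB]

variable {n : ℕ} {p q : ℝ}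

theorem isProbabilityMeasure_sbm (hp0 : 0 ≤ p) (hp1 : p ≤ 1) (hq0 : 0 ≤ q) (hq1 : q ≤ 1) :
    IsProbabilityMeasure (sbm n p q) := by
  have (i j : Fin (2 * n)) :
      IsProbabilityMeasure (bern (if i.val < n ↔ j.val < n then p else q)) := by
    split_ifs
    exacts [isProbabilityMeasure_bern hp0 hp1, isProbabilityMeasure_bern hq0 hq1]
  unfold sbm
  infer_instance

theorem integral_trace_exp_sbm_le {n : ℕ} (hn : 0 < n) {a b : ℝ} (ha0 : 0 ≤ a) (han : a ≤ n)
    (hb0 : 0 ≤ b) (hbn : b ≤ n) (θ : ℝ) :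
    ∫ ω, (exp (θ • (adjOf ω - Bmat n a b) -
      ((Real.exp |θ| - 1 - |θ|) * (a * (1 - a / n) + b * (1 - b / n))) • 1)).trace
        ∂sbm n (a / n) (b / n) ≤ 2 * n := by
  have hn' : (0 : ℝ) < n := by exact_mod_cast hn
  set P : Fin (2 * n) → Fin (2 * n) → ℝ :=
    fun i j => if i.val < n ↔ j.val < n then a / n else b / n with hP
  have hP0 (i j) : 0 ≤ P i j := by simp only [hP]; split_ifs <;> positivity
  have hP1 (i j) : P i j ≤ 1 := by
    simp only [hP]; split_ifs <;> rw [div_le_one hn'] <;> assumption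
  have hprob (i j) : IsProbabilityMeasure (bern (P i j)) :=
    isProbabilityMeasure_bern (hP0 i j) (hP1 i j)
  set φ := Real.exp |θ| - 1 - |θ|
  have hY := TraceExpContractive.pi (fun i => Measure.pi fun j => bern (P i j))
    (fun i ω => ∑ j, ((((if ω j then 1 else 0) - P i j) * θ) • edgeMatrix i j -
      (P i j * (1 - P i j) * φ) • edgeMatrix i j ^ 2)) fun i =>
    TraceExpContractive.pi (fun j => bern (P i j)) (fun j b =>
      (((if b then 1 else 0) - P i j) * θ) • edgeMatrix i j -
        (P i j * (1 - P i j) * φ) • edgeMatrix i j ^ 2) fun j =>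
      TraceExpContractive.bern (hP0 i j) (hP1 i j) θ (edgeMatrix_isSymm i j)
        (edgeMatrix_pow_three i j)
  have h := hY.2 0 Matrix.isSymm_zero
  rw [exp_zero, Matrix.trace_one, Fintype.card_fin] at h
  push_cast at h
  refine le_of_eq_of_le ?_ h
  refine integral_congr_ae (Eventually.of_forall fun ω => ?_)
  simp only [zero_add, Finset.sum_sub_distrib]
  have hsymm (i j) : P i j = P j i := by simp only [hP, iff_comm]
  congr 3
  · rw [sum_smul_edgeMatrix]
    ext i j
    have hB : Bmat n a b i j = P i j := rfl
    simp only [Matrix.smul_apply, Matrix.sub_apply, Matrix.of_apply, adjOf, hB, smul_eq_mul,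
      hsymm j i]
    split_ifs <;> ring
  · rw [sum_smul_edgeMatrix_sq (fun i j => by rw [hsymm])]
    have hrow (i) : ∑ j, P i j * (1 - P i j) * φ = φ * (a * (1 - a / n) + b * (1 - b / n)) := by
      have e (j) : P i j * (1 - P i j) * φ = if i.val < n ↔ j.val < n then
          a / n * (1 - a / n) * φ else b / n * (1 - b / n) * φ := by
        simp only [hP]; split_ifs <;> rfl
      simp only [e]
      rw [sum_block_ite]
      field_simp
    simp only [φ] at hrow
    simp only [hrow, Matrix.smul_one_eq_diagonal, φ]

theorem sbm_tail_le {n : ℕ} (hn : 0 < n) {a b : ℝ} (ha0 : 0 ≤ a) (han : a ≤ n)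
    (hb0 : 0 ≤ b) (hbn : b ≤ n) {θ : ℝ} (hθ : 0 < θ) (t : ℝ) :
    Real.exp (θ * t - (Real.exp θ - 1 - θ) * (a * (1 - a / n) + b * (1 - b / n))) *
      (sbm n (a / n) (b / n)).real {ω | t ≤ specNorm (adjOf ω - Bmat n a b)} ≤ 4 * n := by
  have hn' : (0 : ℝ) < n := by exact_mod_cast hn
  have := isProbabilityMeasure_sbm (n := n) (div_nonneg ha0 hn'.le) ((div_le_one hn').2 han)
    (div_nonneg hb0 hn'.le) ((div_le_one hn').2 hbn)
  set μ := sbm n (a / n) (b / n)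
  set v := (Real.exp θ - 1 - θ) * (a * (1 - a / n) + b * (1 - b / n)) with hv
  have hsym := adjOf_sub_Bmat_isSymm n a b
  have h1 := integral_trace_exp_sbm_le hn ha0 han hb0 hbn θ
  have h2 := integral_trace_exp_sbm_le hn ha0 han hb0 hbn (-θ)
  rw [abs_neg] at h2
  rw [abs_of_pos hθ, ← hv] at h1 h2
  have hmono : μ.real {ω | t ≤ specNorm (adjOf ω - Bmat n a b)} ≤
      μ.real {ω | Real.exp (θ * t - v) ≤ (exp (θ • (adjOf ω - Bmat n a b) - v • 1)).trace +
        (exp (-θ • (adjOf ω - Bmat n a b) - v • 1)).trace} := by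
    refine measureReal_mono fun ω (hω : t ≤ _) => ?_
    refine le_trans (Real.exp_le_exp.2 ?_) (exp_specNorm_le (by omega) (hsym ω) hθ v)
    gcongr
  refine (mul_le_mul_of_nonneg_left hmono (Real.exp_nonneg _)).trans ?_
  refine (mul_meas_ge_le_integral_of_nonneg (Eventually.of_forall fun ω => ?_)
    .of_finite _).trans ?_
  · have hs (x : ℝ) : (x • (adjOf ω - Bmat n a b) - v • 1).IsSymm :=
      ((hsym ω).smul _).sub (Matrix.isSymm_one.smul _)
    exact add_nonneg (trace_exp_nonneg (hs _)) (trace_exp_nonneg (hs _))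
  · rw [integral_add .of_finite .of_finite]
    linarith

end BlockModel

theorem log_two_add_two_mul_log_le {n : ℕ} (hn : 3 ≤ n) :
    Real.log 2 + 2 * Real.log n ≤ 6 * Real.log 2 * Real.log n -
      (3 - 2 * Real.log 2) * Real.log n * (1 - Real.log n / (2 * n)) := by
  have l1 := Real.log_two_gt_d9
  have l2 := Real.log_two_lt_d9
  rcases hn.eq_or_lt with rfl | hn
  · have h3 : 1 ≤ Real.log (3 : ℕ) := by
      rw [Real.le_log_iff_exp_le (by norm_num)]
      exact (Real.exp_one_lt_d9.le).trans (by norm_num)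
    push_cast at h3 ⊢
    nlinarith [mul_le_mul h3 h3 zero_le_one (by linarith)]
  · have hn' : (4 : ℝ) ≤ n := by exact_mod_cast hn
    have hL : 2 * Real.log 2 ≤ Real.log n := by
      rw [← Real.log_rpow two_pos]
      exact Real.log_le_log (by norm_num) (by norm_num; exact_mod_cast hn')
    have h0 : 0 ≤ (3 - 2 * Real.log 2) * Real.log n * (Real.log n / (2 * n)) := by
      have : 0 ≤ Real.log n := by linarith
      have : 0 ≤ 3 - 2 * Real.log 2 := by linarith
      positivity
    nlinarith

/-- If `d := a + b > log n`, then for `G ∼ G_{2n,a/n,b/n}` with adjacency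
matrix `A` and expectation matrix `B = 𝔼[A]`, the probability that `‖A - B‖ ≥ 3·√(d·log n)`
is at most `2/n`. -/
theorem stmt0 (n : ℕ) (hn : 0 < n) (a b : ℝ)
    (ha0 : 0 ≤ a) (han : a ≤ n) (hb0 : 0 ≤ b) (hbn : b ≤ n)
    (hd : Real.log n < a + b) :
    sbm n (a / n) (b / n)
      {ω | 3 * Real.sqrt ((a + b) * Real.log n) ≤ specNorm (adjOf ω - Bmat n a b)}
      ≤ ENNReal.ofReal (2 / n) := by
  have hn' : (0 : ℝ) < n := by exact_mod_cast hn
  have := isProbabilityMeasure_sbm (n := n) (div_nonneg ha0 hn'.le) ((div_le_one hn').2 han)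
    (div_nonneg hb0 hn'.le) ((div_le_one hn').2 hbn)
  rcases le_or_gt n 2 with hn2 | hn3
  · refine prob_le_one.trans ?_
    rw [ENNReal.one_le_ofReal, one_le_div hn']
    exact_mod_cast hn2
  rw [← ofReal_measureReal]
  refine ENNReal.ofReal_le_ofReal ?_
  set L := Real.log n with hLdef
  set d := a + b with hddef
  have hL : 0 < L := Real.log_pos (by exact_mod_cast (by omega : 1 < n))
  have hd0 : 0 < d := hL.trans hd
  set s := Real.sqrt (L / d) with hs
  have hs2 : s ^ 2 = L / d := Real.sq_sqrt (by positivity)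
  have hs0 : 0 < s := Real.sqrt_pos.2 (by positivity)
  have hs1 : s ≤ 1 := Real.sqrt_le_one.2 ((div_le_one hd0).2 hd.le)
  have l1 := Real.log_two_gt_d9
  have l2 := Real.log_two_lt_d9
  have htail := sbm_tail_le hn ha0 han hb0 hbn (θ := s * (2 * Real.log 2)) (by positivity)
    (3 * Real.sqrt (d * L))
  have hst : s * Real.sqrt (d * L) = L := by
    rw [hs, ← Real.sqrt_mul (by positivity), show L / d * (d * L) = L ^ 2 by field_simp,
      Real.sqrt_sq hL.le]
  have hφ : Real.exp (s * (2 * Real.log 2)) - 1 - s * (2 * Real.log 2) ≤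
      L / d * (3 - 2 * Real.log 2) := by
    have h := exp_mul_le_of_abs_le_one (s := s) (by rwa [abs_of_pos hs0]) (2 * Real.log 2)
    have h4 : Real.exp (2 * Real.log 2) = 4 := by
      rw [two_mul, Real.exp_add, Real.exp_log two_pos]; norm_num
    rw [abs_of_pos (by linarith), h4, hs2] at h
    linarith
  have hv0 : 0 ≤ a * (1 - a / n) + b * (1 - b / n) := by
    have := (div_le_one hn').2 han
    have := (div_le_one hn').2 hbn
    exact add_nonneg (mul_nonneg ha0 (by linarith)) (mul_nonneg hb0 (by linarith))
  have hv : a * (1 - a / n) + b * (1 - b / n) ≤ d * (1 - L / (2 * n)) := by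
    have e : d * (1 - L / (2 * n)) - (a * (1 - a / n) + b * (1 - b / n)) =
        (2 * (a ^ 2 + b ^ 2) - d * L) / (2 * n) := by
      rw [hddef]; field_simp; ring
    have : 0 ≤ (2 * (a ^ 2 + b ^ 2) - d * L) / (2 * n) := by
      refine div_nonneg ?_ (by positivity)
      nlinarith [sq_nonneg (a - b), mul_le_mul_of_nonneg_left hd.le hd0.le]
    linarith
  have hφv := mul_le_mul hφ hv hv0 (mul_nonneg (by positivity) (by linarith))
  have hexp : 2 * (n : ℝ) ^ 2 ≤ Real.exp (s * (2 * Real.log 2) * (3 * Real.sqrt (d * L)) -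
      (Real.exp (s * (2 * Real.log 2)) - 1 - s * (2 * Real.log 2)) *
        (a * (1 - a / n) + b * (1 - b / n))) := by
    rw [← Real.log_le_iff_le_exp (by positivity), Real.log_mul two_ne_zero (by positivity),
      Real.log_pow]
    have hnum := log_two_add_two_mul_log_le hn3
    have e1 : s * (2 * Real.log 2) * (3 * Real.sqrt (d * L)) = 6 * Real.log 2 * L := by
      linear_combination 6 * Real.log 2 * hst
    have e2 : L / d * (3 - 2 * Real.log 2) * (d * (1 - L / (2 * n))) =
        (3 - 2 * Real.log 2) * L * (1 - L / (2 * n)) := by field_simp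
    push_cast
    linarith
  have hfin := (mul_le_mul_of_nonneg_right hexp measureReal_nonneg).trans htail
  rw [le_div_iff₀ hn']
  refine le_of_mul_le_mul_left ?_ (by positivity : (0 : ℝ) < 2 * n)
  linarith
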